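/- arXiv:1502.01543 — 2 statements merged into one kernel-verified Lean document; each statement's English description precedes it below -/
import Mathlib

section
/- For all integers n and k with n ≥ k+1 ≥ 2, the average k-zigzagging length of permutations in S_n equals (2(n-k)+4)/3; equivalently, 3 · Σ_{w ∈ S_n} zs_k(w) = (2(n-k)+4) · n!. -/
open Nat

/-- `ι` enumerates (the positions of) an alternating subsequence of `w`:
positions are strictly increasing and the values satisfy `w_{i₁} > w_{i₂} < w_{i₃} > ⋯`. -/
def IsAltSeq {n : ℕ} (w : Equiv.Perm (Fin n)) {s : ℕ} (ι : Fin s → Fin n) : Prop :=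
  StrictMono ι ∧
    ∀ (j : ℕ) (hj : j + 1 < s),
      if j % 2 = 0 then
        (w (ι ⟨j + 1, hj⟩) : ℕ) < (w (ι ⟨j, Nat.lt_of_succ_lt hj⟩) : ℕ)
      else
        (w (ι ⟨j, Nat.lt_of_succ_lt hj⟩) : ℕ) < (w (ι ⟨j + 1, hj⟩) : ℕ)

/-- `ι` enumerates a reverse alternating subsequence of `w`:
`w_{i₁} < w_{i₂} > w_{i₃} < ⋯`. -/
def IsRevAltSeq {n : ℕ} (w : Equiv.Perm (Fin n)) {s : ℕ} (ι : Fin s → Fin n) : Prop :=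
  StrictMono ι ∧
    ∀ (j : ℕ) (hj : j + 1 < s),
      if j % 2 = 0 then
        (w (ι ⟨j, Nat.lt_of_succ_lt hj⟩) : ℕ) < (w (ι ⟨j + 1, hj⟩) : ℕ)
      else
        (w (ι ⟨j + 1, hj⟩) : ℕ) < (w (ι ⟨j, Nat.lt_of_succ_lt hj⟩) : ℕ)

/-- Each pair of neighbouring entries of the subsequence differs by at least `k`
in absolute value. -/
def HasGaps (k : ℕ) {n : ℕ} (w : Equiv.Perm (Fin n)) {s : ℕ} (ι : Fin s → Fin n) : Prop :=
  ∀ (j : ℕ) (hj : j + 1 < s),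
    (k : ℤ) ≤ |((w (ι ⟨j, Nat.lt_of_succ_lt hj⟩) : ℕ) : ℤ) -
               ((w (ι ⟨j + 1, hj⟩) : ℕ) : ℤ)|

/-- `as_k(w)`: the maximal length of a `k`-alternating subsequence of `w`. -/
noncomputable def kAltLen (n k : ℕ) (w : Equiv.Perm (Fin n)) : ℕ :=
  sSup {s : ℕ | ∃ ι : Fin s → Fin n, IsAltSeq w ι ∧ HasGaps k w ι}

/-- The maximal length of a `k`-reverse-alternating subsequence of `w`. -/
noncomputable def kRevAltLen (n k : ℕ) (w : Equiv.Perm (Fin n)) : ℕ :=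
  sSup {s : ℕ | ∃ ι : Fin s → Fin n, IsRevAltSeq w ι ∧ HasGaps k w ι}

/-- `zs_k(w)`: the maximal length of a `k`-zigzagging subsequence of `w`. -/
noncomputable def kZigLen (n k : ℕ) (w : Equiv.Perm (Fin n)) : ℕ :=
  sSup {s : ℕ | ∃ ι : Fin s → Fin n, (IsAltSeq w ι ∨ IsRevAltSeq w ι) ∧ HasGaps k w ι}

/-- The section `w_s ⋯ w_t` is a `k`-up: `s < t` and `w_t - w_s ≥ k`. -/
def IsKUp (k : ℕ) {n : ℕ} (w : Equiv.Perm (Fin n)) (s t : Fin n) : Prop :=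
  s < t ∧ (w s : ℕ) + k ≤ (w t : ℕ)

/-- The section `w_s ⋯ w_t` is a `k`-down: `s < t` and `w_s - w_t ≥ k`. -/
def IsKDown (k : ℕ) {n : ℕ} (w : Equiv.Perm (Fin n)) (s t : Fin n) : Prop :=
  s < t ∧ (w t : ℕ) + k ≤ (w s : ℕ)

/-- The section `w_i ⋯ w_j` is `k`-ascending: `w_i` is its minimum, `w_j` its maximum,
`w_j - w_i ≥ k`, and there is no `k`-down inside it. -/
def IsKAsc (k : ℕ) {n : ℕ} (w : Equiv.Perm (Fin n)) (i j : Fin n) : Prop :=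
  i < j ∧
  (∀ t : Fin n, i ≤ t → t ≤ j → (w i : ℕ) ≤ (w t : ℕ) ∧ (w t : ℕ) ≤ (w j : ℕ)) ∧
  (w i : ℕ) + k ≤ (w j : ℕ) ∧
  ∀ s t : Fin n, i ≤ s → t ≤ j → ¬ IsKDown k w s t

/-- The section `w_i ⋯ w_j` is `k`-descending: `w_i` is its maximum, `w_j` its minimum,
`w_i - w_j ≥ k`, and there is no `k`-up inside it. -/
def IsKDesc (k : ℕ) {n : ℕ} (w : Equiv.Perm (Fin n)) (i j : Fin n) : Prop :=
  i < j ∧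
  (∀ t : Fin n, i ≤ t → t ≤ j → (w t : ℕ) ≤ (w i : ℕ) ∧ (w j : ℕ) ≤ (w t : ℕ)) ∧
  (w j : ℕ) + k ≤ (w i : ℕ) ∧
  ∀ s t : Fin n, i ≤ s → t ≤ j → ¬ IsKUp k w s t

/-- `w_i ⋯ w_j` is a maximal `k`-ascending section: it is `k`-ascending and it is not
contained in any other `k`-ascending section. -/
def IsMaxKAsc (k : ℕ) {n : ℕ} (w : Equiv.Perm (Fin n)) (i j : Fin n) : Prop :=
  IsKAsc k w i j ∧ ∀ i' j' : Fin n, IsKAsc k w i' j' → i' ≤ i → j ≤ j' → i' = i ∧ j' = j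

/-- `w_i ⋯ w_j` is a maximal `k`-descending section. -/
def IsMaxKDesc (k : ℕ) {n : ℕ} (w : Equiv.Perm (Fin n)) (i j : Fin n) : Prop :=
  IsKDesc k w i j ∧ ∀ i' j' : Fin n, IsKDesc k w i' j' → i' ≤ i → j ≤ j' → i' = i ∧ j' = j

/-- `w_p` is a `k`-peak of `w`: `p` is the right end of a maximal `k`-ascending section
or the left end of a maximal `k`-descending section. -/
def IsKPeakPos (k : ℕ) {n : ℕ} (w : Equiv.Perm (Fin n)) (p : Fin n) : Prop :=
  (∃ i, IsMaxKAsc k w i p) ∨ (∃ j, IsMaxKDesc k w p j)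

/-- `w_p` is a `k`-valley of `w`: `p` is the left end of a maximal `k`-ascending section
or the right end of a maximal `k`-descending section. -/
def IsKValleyPos (k : ℕ) {n : ℕ} (w : Equiv.Perm (Fin n)) (p : Fin n) : Prop :=
  (∃ j, IsMaxKAsc k w p j) ∨ (∃ i, IsMaxKDesc k w i p)

section Peaks

variable {α : Type*} [LinearOrder α] {k : ℤ} {f : α → ℤ}

/-- `p` is a `k`-prominent local maximum of `f`: on either side of `p`, a value `≤ f p - k` is
met before any value `> f p`. Prominent local minima of `f` are the peaks of `-f`. -/
def IsProminent (k : ℤ) (f : α → ℤ) (p : α) : Prop :=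
  (∃ q, f q + k ≤ f p) ∧
  (∀ q < p, f p < f q → ∃ r, q < r ∧ r < p ∧ f r + k ≤ f p) ∧
  (∀ q, p < q → f p < f q → ∃ r, p < r ∧ r < q ∧ f r + k ≤ f p)

theorem exists_isProminent_mem (hk : 0 < k) (S : Finset α) {x : α} (hx : x ∈ S)
    (hlow : ∃ q, f q + k ≤ f x)
    (hleft : ∀ q ∉ S, ∀ p ∈ S, q < p → ∃ r, q ≤ r ∧ r < p ∧ f r + k ≤ f x)
    (hright : ∀ q ∉ S, ∀ p ∈ S, p < q → ∃ r, p < r ∧ r ≤ q ∧ f r + k ≤ f x) :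
    ∃ p ∈ S, IsProminent k f p := by
  obtain ⟨p, hp, hmax⟩ := S.exists_max_image f ⟨x, hx⟩
  have hxp := hmax x hx
  refine ⟨p, hp, ?_, ?_, ?_⟩
  · obtain ⟨q, hq⟩ := hlow
    exact ⟨q, by lia⟩
  · intro q hqp hq
    have hqS : q ∉ S := fun h => by have := hmax q h; lia
    obtain ⟨r, h1, h2, h3⟩ := hleft q hqS p hp hqp
    refine ⟨r, lt_of_le_of_ne h1 ?_, h2, by lia⟩
    rintro rfl
    lia
  · intro q hqp hq
    have hqS : q ∉ S := fun h => by have := hmax q h; lia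
    obtain ⟨r, h1, h2, h3⟩ := hright q hqS p hp hqp
    refine ⟨r, h1, lt_of_le_of_ne h2 ?_, by lia⟩
    rintro rfl
    lia

variable [Fintype α]

theorem exists_isProminent_between (hk : 0 < k) {a b c : α} (hac : a < c) (hcb : c < b)
    (ha : f a + k ≤ f c) (hb : f b + k ≤ f c) : ∃ p, a < p ∧ p < b ∧ IsProminent k f p := by
  classical
  obtain ⟨p, hp, h⟩ := exists_isProminent_mem hk (Finset.univ.filter fun x => a < x ∧ x < b)
    (x := c) (f := f) (by simp [hac, hcb]) ⟨a, ha⟩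
    (by
      intro q hq p hp hqp
      simp only [Finset.mem_filter, Finset.mem_univ, true_and, not_and, not_lt] at hq hp
      refine ⟨a, ?_, hp.1, ha⟩
      by_contra! h
      exact absurd (hq h) (not_le.2 (hqp.trans hp.2)))
    (by
      intro q hq p hp hqp
      simp only [Finset.mem_filter, Finset.mem_univ, true_and, not_and, not_lt] at hq hp
      exact ⟨b, hp.2, hq (hp.1.trans hqp), hb⟩)
  simp only [Finset.mem_filter, Finset.mem_univ, true_and] at hp
  exact ⟨p, hp.1, hp.2, h⟩

theorem IsProminent.gap_le {e e' : α} (hee : e ≤ e') (hp : IsProminent k f e)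
    (hv : IsProminent k (-f) e') (hmax : ∀ t, e ≤ t → t ≤ e' → f t ≤ f e)
    (hmin : ∀ t, e ≤ t → t ≤ e' → f e' ≤ f t) : f e' + k ≤ f e := by
  by_contra! hlt
  obtain ⟨⟨q, hq⟩, hpl, hpr⟩ := hp
  obtain ⟨-, hvl, hvr⟩ := hv
  simp only [Pi.neg_apply] at hvl hvr
  have hout : ∀ q, f q + k ≤ f e → e ≤ q → e' < q := by
    intro q hq heq
    by_contra! hqe
    have := hmin q heq hqe
    lia
  have hleft : ∀ q, q < e → ¬ f q + k ≤ f e := by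
    intro q
    induction q using WellFoundedGT.induction with
    | _ q ih =>
      intro hqe hq
      obtain ⟨r, hqr, hre, hr⟩ := hvl q (hqe.trans_le hee) (by lia)
      have hre' : r < e := by
        by_contra! h
        have := hmax r h hre.le
        lia
      obtain ⟨t, hrt, hte, ht⟩ := hpl r hre' (by lia)
      exact ih t (hqr.trans hrt) hte ht
  have hright : ∀ q, e' < q → ¬ f q + k ≤ f e := by
    intro q
    induction q using WellFoundedLT.induction with
    | _ q ih =>
      intro hqe hq
      obtain ⟨r, her, hrq, hr⟩ := hvr q hqe (by lia)
      obtain ⟨t, het, htr, ht⟩ := hpr r (hee.trans_lt her) (by lia)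
      exact ih t (htr.trans hrq) (hout t ht het.le) ht
  rcases lt_or_ge q e with h | h
  · exact hleft q h hq
  · exact hright q (hout q hq h) hq

theorem IsProminent.not_neg (hk : 0 < k) {p : α} (hp : IsProminent k f p) :
    ¬ IsProminent k (-f) p := by
  intro hv
  have h : ∀ t, p ≤ t → t ≤ p → t = p := fun t h1 h2 => le_antisymm h2 h1
  have := hp.gap_le le_rfl hv (fun t h1 h2 => (h t h1 h2 ▸ le_rfl))
    (fun t h1 h2 => (h t h1 h2 ▸ le_rfl))
  lia

theorem IsProminent.next (hk : 0 < k) (hf : Function.Injective f) {e e' : α} (hee : e < e')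
    (hno : ∀ p, e < p → p < e' → ¬ IsProminent k f p ∧ ¬ IsProminent k (-f) p)
    (hp : IsProminent k f e) (he' : IsProminent k f e' ∨ IsProminent k (-f) e') :
    IsProminent k (-f) e' ∧ f e' + k ≤ f e := by
  have hmax : ∀ t, e ≤ t → t ≤ e' → f t ≤ f e := by
    intro t h1 h2
    by_contra! h
    have h1' : e < t := lt_of_le_of_ne h1 (by rintro rfl; lia)
    obtain ⟨r, hr1, hr2, hr⟩ := hp.2.2 t h1' h
    obtain ⟨v, hv1, hv2, hv⟩ := exists_isProminent_between (f := -f) hk hr1 hr2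
      (by simp only [Pi.neg_apply]; lia) (by simp only [Pi.neg_apply]; lia)
    exact (hno v hv1 (hv2.trans_le h2)).2 hv
  have hv : IsProminent k (-f) e' := by
    refine he'.resolve_left fun hp' => ?_
    have h1 : f e' ≠ f e := hf.ne hee.ne'
    have h2 := hmax e' hee.le le_rfl
    obtain ⟨r, hr1, hr2, hr⟩ := hp'.2.1 e hee (by lia)
    obtain ⟨v, hv1, hv2, hv⟩ := exists_isProminent_between (f := -f) hk hr1 hr2
      (by simp only [Pi.neg_apply]; lia) (by simp only [Pi.neg_apply]; lia)
    exact (hno v hv1 hv2).2 hv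
  refine ⟨hv, hp.gap_le hee.le hv hmax ?_⟩
  intro t h1 h2
  by_contra! h
  have h2' : t < e' := lt_of_le_of_ne h2 (by rintro rfl; lia)
  obtain ⟨r, hr1, hr2, hr⟩ := hv.2.1 t h2' (by simp only [Pi.neg_apply]; lia)
  simp only [Pi.neg_apply] at hr
  obtain ⟨v, hv1, hv2, hv⟩ := exists_isProminent_between (f := f) hk hr1 hr2
    (by lia) (by lia)
  exact (hno v (h1.trans_lt hv1) hv2).1 hv

/-- `ι` enumerates a subsequence of `f` that starts with a descent, whose ascents and descents
alternate and are all of height at least `k`. -/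
def IsZigzag (k : ℤ) (f : α → ℤ) {s : ℕ} (ι : Fin s → α) : Prop :=
  StrictMono ι ∧ ∀ (j : ℕ) (hj : j + 1 < s),
    if j % 2 = 0 then f (ι ⟨j + 1, hj⟩) + k ≤ f (ι ⟨j, Nat.lt_of_succ_lt hj⟩)
    else f (ι ⟨j, Nat.lt_of_succ_lt hj⟩) + k ≤ f (ι ⟨j + 1, hj⟩)

open Classical in
/-- The `k`-prominent local maxima and minima of `f`. -/
noncomputable def prominentSet (k : ℤ) (f : α → ℤ) : Finset α :=
  Finset.univ.filter fun p => IsProminent k f p ∨ IsProminent k (-f) p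

theorem mem_prominentSet {p : α} :
    p ∈ prominentSet k f ↔ IsProminent k f p ∨ IsProminent k (-f) p := by
  simp [prominentSet]

theorem prominentSet_neg : prominentSet k (-f) = prominentSet k f := by
  ext p
  simp [mem_prominentSet, or_comm]

theorem exists_isProminent_near (hk : 0 < k) {s : ℕ} {ι : Fin s → α} (hι : StrictMono ι)
    (hs : 2 ≤ s) (j : Fin s)
    (hj : ∀ i : Fin s, (i : ℕ) + 1 = j ∨ (i : ℕ) = j + 1 → f (ι i) + k ≤ f (ι j)) :
    ∃ p, (∀ i : Fin s, ((i : ℕ) + 1 = j → ι i < p) ∧ ((i : ℕ) = j + 1 → p < ι i)) ∧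
      IsProminent k f p := by
  classical
  obtain ⟨p, hp, h⟩ := exists_isProminent_mem hk (f := f) (x := ι j) (Finset.univ.filter fun p =>
      ∀ i : Fin s, ((i : ℕ) + 1 = j → ι i < p) ∧ ((i : ℕ) = j + 1 → p < ι i))
    (by
      simp only [Finset.mem_filter, Finset.mem_univ, true_and]
      exact fun i => ⟨fun h => hι (Fin.lt_def.2 (by lia)), fun h => hι (Fin.lt_def.2 (by lia))⟩)
    (by
      by_cases h0 : (j : ℕ) = 0
      · exact ⟨ι ⟨1, by lia⟩, hj _ (Or.inr (by simp [h0]))⟩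
      · exact ⟨ι ⟨j - 1, by lia⟩, hj _ (Or.inl (by simp; lia))⟩)
    (by
      intro q hq p hp hqp
      simp only [Finset.mem_filter, Finset.mem_univ, true_and, not_forall] at hq hp
      obtain ⟨i, hi⟩ := hq
      rw [not_and_or, Classical.not_imp, Classical.not_imp, not_lt, not_lt] at hi
      rcases hi with ⟨h1, h2⟩ | ⟨h1, h2⟩
      · exact ⟨ι i, h2, (hp i).1 h1, hj i (Or.inl h1)⟩
      · exact absurd (((hp i).2 h1).trans_le h2) hqp.not_gt)
    (by
      intro q hq p hp hqp
      simp only [Finset.mem_filter, Finset.mem_univ, true_and, not_forall] at hq hp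
      obtain ⟨i, hi⟩ := hq
      rw [not_and_or, Classical.not_imp, Classical.not_imp, not_lt, not_lt] at hi
      rcases hi with ⟨h1, h2⟩ | ⟨h1, h2⟩
      · exact absurd (h2.trans_lt ((hp i).1 h1)) hqp.not_gt
      · exact ⟨ι i, (hp i).2 h1, h2, hj i (Or.inr h1)⟩)
  simp only [Finset.mem_filter, Finset.mem_univ, true_and] at hp
  exact ⟨p, hp, h⟩

theorem IsZigzag.le_card (hk : 0 < k) (hf : ∃ a b, f a + k ≤ f b) {s : ℕ} {ι : Fin s → α}
    (h : IsZigzag k f ι) : s ≤ (prominentSet k f).card := by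
  obtain ⟨hι, hz⟩ := h
  rcases Nat.lt_or_ge s 2 with hs | hs
  · obtain ⟨a, b, hab⟩ := hf
    obtain ⟨p, -, hp⟩ := exists_isProminent_mem (f := f) hk Finset.univ (Finset.mem_univ b)
      ⟨a, hab⟩ (by simp) (by simp)
    have : 0 < (prominentSet k f).card :=
      Finset.card_pos.2 ⟨p, mem_prominentSet.2 (Or.inl hp)⟩
    lia
  have hz' : ∀ a b : Fin s, (a : ℕ) + 1 = b →
      if (a : ℕ) % 2 = 0 then f (ι b) + k ≤ f (ι a) else f (ι a) + k ≤ f (ι b) := by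
    rintro ⟨a, ha⟩ ⟨b, hb⟩ h
    obtain rfl : a + 1 = b := h
    exact hz a hb
  have key : ∀ j : Fin s, ∃ p,
      (∀ i : Fin s, ((i : ℕ) + 1 = j → ι i < p) ∧ ((i : ℕ) = j + 1 → p < ι i)) ∧
      (if (j : ℕ) % 2 = 0 then IsProminent k f p else IsProminent k (-f) p) := by
    intro j
    by_cases hj : (j : ℕ) % 2 = 0
    · simp only [hj, if_true]
      refine exists_isProminent_near hk hι hs j ?_
      rintro i (hi | hi)
      · have := hz' i j hi
        rwa [if_neg (by lia)] at this
      · have := hz' j i hi.symm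
        rwa [if_pos hj] at this
    · simp only [hj, if_false]
      refine exists_isProminent_near hk hι hs j ?_
      simp only [Pi.neg_apply]
      rintro i (hi | hi)
      · have := hz' i j hi
        rw [if_pos (by lia)] at this
        lia
      · have := hz' j i hi.symm
        rw [if_neg hj] at this
        lia
  choose g hg hpg using key
  have hlt : ∀ a b : Fin s, a < b → g a ≠ g b := by
    intro a b hab heq
    have ha := hpg a
    have hb := hpg b
    by_cases hpar : (a : ℕ) % 2 = (b : ℕ) % 2
    · have hab' : (a : ℕ) < b := hab
      have h1 := (hg a ⟨a + 1, by lia⟩).2 rfl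
      have h2 := (hg b ⟨b - 1, by lia⟩).1 (by simp; lia)
      have h3 : ι ⟨a + 1, by lia⟩ ≤ ι ⟨b - 1, by lia⟩ :=
        hι.monotone (Fin.le_def.2 (by simp; lia))
      exact absurd heq ((h1.trans_le h3).trans h2).ne
    · rw [heq] at ha
      split_ifs at ha hb with h1 h2 h2
      · lia
      · exact ha.not_neg hk hb
      · exact hb.not_neg hk ha
      · lia
  have hinj : Function.Injective g := by
    intro a b hab
    rcases lt_trichotomy a b with h | h | h
    · exact absurd hab (hlt a b h)
    · exact h
    · exact absurd hab.symm (hlt b a h)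
  calc s = (Finset.univ : Finset (Fin s)).card := by simp
    _ ≤ _ := by
      refine Finset.card_le_card_of_injOn g (fun j _ => ?_) hinj.injOn
      rw [Finset.mem_coe, mem_prominentSet]
      have := hpg j
      split_ifs at this
      · exact Or.inl this
      · exact Or.inr this

theorem isZigzag_of_isProminent (hk : 0 < k) (hf : Function.Injective f) {s : ℕ} {ι : Fin s → α}
    (hι : StrictMono ι) (hmem : ∀ j, ι j ∈ prominentSet k f)
    (hno : ∀ (j : ℕ) (hj : j + 1 < s) (p), ι ⟨j, Nat.lt_of_succ_lt hj⟩ < p → p < ι ⟨j + 1, hj⟩ →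
      p ∉ prominentSet k f)
    (h0 : ∀ hs : 0 < s, IsProminent k f (ι ⟨0, hs⟩)) : IsZigzag k f ι := by
  have up := fun (j : ℕ) (hj : j + 1 < s) (h : IsProminent k f (ι ⟨j, Nat.lt_of_succ_lt hj⟩)) =>
    h.next hk hf (e' := ι ⟨j + 1, hj⟩) (hι (Fin.lt_def.2 (Nat.lt_succ_self j)))
      (fun p h1 h2 => by
        have := hno j hj p h1 h2
        rwa [mem_prominentSet, not_or] at this) (mem_prominentSet.1 (hmem _))
  have down := fun (j : ℕ) (hj : j + 1 < s)
      (h : IsProminent k (-f) (ι ⟨j, Nat.lt_of_succ_lt hj⟩)) =>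
    h.next (f := -f) hk (neg_injective.comp hf) (e' := ι ⟨j + 1, hj⟩) (hι (Fin.lt_def.2 (Nat.lt_succ_self j)))
      (fun p h1 h2 => by
        have := hno j hj p h1 h2
        rwa [← prominentSet_neg, mem_prominentSet, not_or] at this)
      (mem_prominentSet.1 (prominentSet_neg (f := f) ▸ hmem _))
  rw [neg_neg] at down
  simp only [Pi.neg_apply] at down
  have par : ∀ (j : ℕ) (hj : j < s),
      if j % 2 = 0 then IsProminent k f (ι ⟨j, hj⟩) else IsProminent k (-f) (ι ⟨j, hj⟩) := by
    intro j
    induction j with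
    | zero => intro hj; simpa using h0 hj
    | succ j ih =>
      intro hj
      have := ih (by lia)
      split_ifs at this with h
      · rw [if_neg (by lia)]
        exact (up j hj this).1
      · rw [if_pos (by lia)]
        exact (down j hj this).1
  refine ⟨hι, fun j hj => ?_⟩
  have := par j (by lia)
  split_ifs at this ⊢ with h
  · exact (up j hj this).2
  · have := (down j hj this).2
    lia

theorem exists_isZigzag (hk : 0 < k) (hf : Function.Injective f) :
    ∃ ι : Fin (prominentSet k f).card → α, IsZigzag k f ι ∨ IsZigzag k (-f) ι := by
  set E := prominentSet k f
  have hι : StrictMono (E.orderEmbOfFin rfl) := (E.orderEmbOfFin rfl).strictMono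
  have hmem : ∀ j, E.orderEmbOfFin rfl j ∈ E := fun j => E.orderEmbOfFin_mem rfl j
  have hno : ∀ (j : ℕ) (hj : j + 1 < E.card) (p),
      E.orderEmbOfFin rfl ⟨j, Nat.lt_of_succ_lt hj⟩ < p → p < E.orderEmbOfFin rfl ⟨j + 1, hj⟩ →
      p ∉ E := by
    intro j hj p h1 h2 hp
    obtain ⟨i, rfl⟩ : p ∈ Set.range (E.orderEmbOfFin rfl) := by
      rw [Finset.range_orderEmbOfFin]; exact hp
    rw [hι.lt_iff_lt, Fin.lt_def] at h1 h2
    simp only at h1 h2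
    lia
  refine ⟨E.orderEmbOfFin rfl, ?_⟩
  by_cases hs : 0 < E.card
  · rcases mem_prominentSet.1 (hmem ⟨0, hs⟩) with h | h
    · exact Or.inl (isZigzag_of_isProminent hk hf hι hmem hno fun _ => h)
    · refine Or.inr (isZigzag_of_isProminent (f := -f) hk (neg_injective.comp hf) hι ?_ ?_ fun _ => h)
      · rwa [prominentSet_neg]
      · rwa [prominentSet_neg]
  · exact Or.inl ⟨hι, fun j hj => by lia⟩

end Peaks

section Perm

variable {n : ℕ}

theorem isAltSeq_and_hasGaps_iff {k : ℕ} (hk : 0 < k) (w : Equiv.Perm (Fin n)) {s : ℕ}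
    (ι : Fin s → Fin n) :
    IsAltSeq w ι ∧ HasGaps k w ι ↔ IsZigzag k (fun i => ((w i : ℕ) : ℤ)) ι := by
  unfold IsAltSeq HasGaps IsZigzag
  rw [and_assoc, ← forall_and]
  refine and_congr_right fun _ => forall_congr' fun j => ?_
  rw [← forall_and]
  refine forall_congr' fun hj => ?_
  rw [le_abs]
  split_ifs <;> lia

theorem isRevAltSeq_and_hasGaps_iff {k : ℕ} (hk : 0 < k) (w : Equiv.Perm (Fin n)) {s : ℕ}
    (ι : Fin s → Fin n) :
    IsRevAltSeq w ι ∧ HasGaps k w ι ↔ IsZigzag k (-fun i => ((w i : ℕ) : ℤ)) ι := by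
  unfold IsRevAltSeq HasGaps IsZigzag
  rw [and_assoc, ← forall_and]
  refine and_congr_right fun _ => forall_congr' fun j => ?_
  rw [← forall_and]
  refine forall_congr' fun hj => ?_
  rw [le_abs]
  simp only [Pi.neg_apply]
  split_ifs <;> lia

theorem kZigLen_eq_card {k : ℕ} (hk : 0 < k) (hkn : k + 1 ≤ n) (w : Equiv.Perm (Fin n)) :
    kZigLen n k w = (prominentSet k (fun i => ((w i : ℕ) : ℤ))).card := by
  have hk' : (0 : ℤ) < k := by exact_mod_cast hk
  have hinj : Function.Injective (fun i => ((w i : ℕ) : ℤ)) := by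
    intro a b h
    simpa [Fin.val_inj] using h
  have hex : ∃ a b, ((w a : ℕ) : ℤ) + k ≤ ((w b : ℕ) : ℤ) :=
    ⟨w.symm ⟨0, by lia⟩, w.symm ⟨n - 1, by lia⟩, by simp; lia⟩
  refine IsGreatest.csSup_eq ⟨?_, ?_⟩
  · obtain ⟨ι, h⟩ := exists_isZigzag hk' hinj
    refine ⟨ι, ?_⟩
    rw [or_and_right, isAltSeq_and_hasGaps_iff hk, isRevAltSeq_and_hasGaps_iff hk]
    exact h
  · rintro s ⟨ι, h⟩
    rw [or_and_right, isAltSeq_and_hasGaps_iff hk, isRevAltSeq_and_hasGaps_iff hk] at h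
    rcases h with h | h
    · exact h.le_card hk' hex
    · rw [← prominentSet_neg]
      obtain ⟨a, b, hab⟩ := hex
      exact h.le_card hk' ⟨b, a, by simp only [Pi.neg_apply]; lia⟩

theorem isProminent_congr {α : Type*} [LinearOrder α] {k : ℤ} {f g : α → ℤ} {p : α}
    (h : ∀ a b, f a - f b = g a - g b) : IsProminent k f p ↔ IsProminent k g p := by
  have h1 : ∀ a b, f a < f b ↔ g a < g b := fun a b => by have := h a b; lia
  have h2 : ∀ a b, f a + k ≤ f b ↔ g a + k ≤ g b := fun a b => by have := h a b; lia
  simp only [IsProminent, h1, h2]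

open Classical in
/-- The number of `k`-prominent local maxima of a permutation. -/
noncomputable def peakCount (k : ℕ) (w : Equiv.Perm (Fin n)) : ℕ :=
  (Finset.univ.filter fun p => IsProminent (k : ℤ) (fun i => ((w i : ℕ) : ℤ)) p).card

theorem card_prominentSet {k : ℕ} (hk : 0 < k) (w : Equiv.Perm (Fin n)) :
    (prominentSet k (fun i => ((w i : ℕ) : ℤ))).card
      = peakCount k w + peakCount k (Fin.revPerm * w) := by
  classical
  rw [prominentSet, Finset.filter_or, Finset.card_union_of_disjoint]
  · unfold peakCount
    congr 2
    ext p
    simp only [Finset.mem_filter, Finset.mem_univ, true_and]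
    refine isProminent_congr fun a b => ?_
    simp only [Pi.neg_apply, Equiv.Perm.mul_apply, Fin.revPerm_apply, Fin.val_rev]
    omega
  · rw [Finset.disjoint_filter]
    exact fun p _ hp => hp.not_neg (by exact_mod_cast hk)

/-- Read along increasing `f`, the nearest neighbours of `l` are smaller than `l` in index. -/
def IsNeighborMax {m : ℕ} (l : Fin m) (f : Fin m → ℕ) : Prop :=
  ∀ h, l < h → (f h < f l → ∃ r, r < l ∧ f h < f r ∧ f r < f l) ∧
    (f l < f h → ∃ r, r < l ∧ f l < f r ∧ f r < f h)

theorem isNeighborMax_comp {m N : ℕ} (l : Fin m) (ρ : Fin m → Fin m) {g : Fin m → Fin N}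
    (hg : StrictMono g) :
    IsNeighborMax l (fun i => (g (ρ i) : ℕ)) ↔ IsNeighborMax l (fun i => (ρ i : ℕ)) := by
  have : ∀ i j, (g (ρ i) : ℕ) < g (ρ j) ↔ (ρ i : ℕ) < ρ j := fun i j => hg.lt_iff_lt
  simp only [IsNeighborMax, this]

open Classical in
theorem factorial_mul_card_isNeighborMax {M N : ℕ} (e : Fin M ↪ Fin N) (l : Fin M) :
    M ! * (Finset.univ.filter fun σ : Equiv.Perm (Fin N) =>
        IsNeighborMax l fun i => (σ (e i) : ℕ)).card
      = N ! * (Finset.univ.filter fun ρ : Equiv.Perm (Fin M) =>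
        IsNeighborMax l fun i => (ρ i : ℕ)).card := by
  simp only [Finset.card_filter]
  have h1 : ∀ τ : Equiv.Perm (Fin M),
      (∑ σ : Equiv.Perm (Fin N), if IsNeighborMax l (fun i => (σ (e (τ i)) : ℕ)) then 1 else 0)
        = ∑ σ : Equiv.Perm (Fin N), if IsNeighborMax l (fun i => (σ (e i) : ℕ)) then 1 else 0 := by
    intro τ
    symm
    rw [← Equiv.sum_comp (Equiv.mulRight (τ.viaEmbedding e))]
    simp [Equiv.Perm.viaEmbedding_apply]
  have h2 : ∀ σ : Equiv.Perm (Fin N),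
      (∑ τ : Equiv.Perm (Fin M), if IsNeighborMax l (fun i => (σ (e (τ i)) : ℕ)) then 1 else 0)
        = ∑ ρ : Equiv.Perm (Fin M), if IsNeighborMax l (fun i => (ρ i : ℕ)) then 1 else 0 := by
    intro σ
    have hinj : Function.Injective (σ ∘ e) := σ.injective.comp e.injective
    set s := Tuple.sort (σ ∘ e)
    have hs : StrictMono ((σ ∘ e) ∘ s) :=
      (Tuple.monotone_sort _).strictMono_of_injective (hinj.comp s.injective)
    rw [← Equiv.sum_comp (Equiv.mulLeft s)]
    refine Finset.sum_congr rfl fun ρ _ => if_congr ?_ rfl rfl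
    exact isNeighborMax_comp l ρ hs
  calc _ = ∑ τ : Equiv.Perm (Fin M), ∑ σ : Equiv.Perm (Fin N),
        (if IsNeighborMax l (fun i => (σ (e (τ i)) : ℕ)) then 1 else 0) := by
          simp only [h1]
          simp [Fintype.card_perm]
    _ = _ := by
          rw [Finset.sum_comm]
          simp only [h2]
          simp [Fintype.card_perm]

/-- The embedding of `Fin (1 + m)` into `Fin (k + m)` that skips the `k - 1` values just below
`k + j`. -/
def skipEmb (k m : ℕ) (hk : 0 < k) (j : Fin m) : Fin (1 + m) ↪ Fin (k + m) where
  toFun i := ⟨if (i : ℕ) ≤ j then i else i + k - 1, by split_ifs <;> lia⟩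
  inj' a b h := by
    simp only [Fin.mk.injEq] at h
    split_ifs at h <;> exact Fin.ext (by lia)

theorem skipEmb_of_le {k m : ℕ} (hk : 0 < k) (j : Fin m) (i : Fin (1 + m)) (h : (i : ℕ) ≤ j) :
    (skipEmb k m hk j i : ℕ) = i :=
  if_pos h

theorem skipEmb_of_lt {k m : ℕ} (hk : 0 < k) (j : Fin m) (i : Fin (1 + m)) (h : (j : ℕ) < i) :
    (skipEmb k m hk j i : ℕ) = i + k - 1 :=
  if_neg h.not_ge

theorem isProminent_symm_iff {k m : ℕ} (hk : 0 < k) (σ : Equiv.Perm (Fin (k + m))) (j : Fin m) :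
    IsProminent (k : ℤ) (fun i => ((σ.symm i : ℕ) : ℤ)) (σ (Fin.natAdd k j)) ↔
      IsNeighborMax (Fin.natAdd 1 j) fun i => (σ (skipEmb k m hk j i) : ℕ) := by
  have hl : skipEmb k m hk j (Fin.natAdd 1 j) = Fin.natAdd k j := by
    ext
    rw [skipEmb_of_lt hk _ _ (by simp)]
    simp
    lia
  have lift_high : ∀ v : Fin (k + m), Fin.natAdd k j < v →
      ∃ h : Fin (1 + m), Fin.natAdd 1 j < h ∧ skipEmb k m hk j h = v := by
    intro v hv
    simp only [Fin.lt_def, Fin.val_natAdd] at hv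
    refine ⟨⟨v + 1 - k, by lia⟩, by simp only [Fin.lt_def, Fin.val_natAdd]; lia, ?_⟩
    ext
    rw [skipEmb_of_lt hk _ _ (by simp only; lia)]
    simp only
    lia
  have lift_low : ∀ v : Fin (k + m), (v : ℕ) ≤ j →
      ∃ r : Fin (1 + m), r < Fin.natAdd 1 j ∧ skipEmb k m hk j r = v := by
    intro v hv
    refine ⟨⟨v, by lia⟩, by simp only [Fin.lt_def, Fin.val_natAdd]; lia, ?_⟩
    ext
    rw [skipEmb_of_le hk _ _ hv]
  have high : ∀ h : Fin (1 + m), Fin.natAdd 1 j < h →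
      Fin.natAdd k j < skipEmb k m hk j h := by
    intro h hh
    simp only [Fin.lt_def, Fin.val_natAdd] at hh ⊢
    rw [skipEmb_of_lt hk _ _ (by lia)]
    lia
  have low : ∀ r : Fin (1 + m), r < Fin.natAdd 1 j → (skipEmb k m hk j r : ℕ) ≤ j := by
    intro r hr
    simp only [Fin.lt_def, Fin.val_natAdd] at hr
    rw [skipEmb_of_le hk _ _ (by lia)]
    lia
  unfold IsProminent IsNeighborMax
  simp only [hl, Equiv.symm_apply_apply]
  constructor
  · rintro ⟨-, h1, h2⟩ h hh
    have hv := Fin.lt_def.1 (high h hh)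
    refine ⟨fun hlt => ?_, fun hlt => ?_⟩
    · obtain ⟨r, hr1, hr2, hr⟩ := h1 (σ (skipEmb k m hk j h)) (Fin.lt_def.2 hlt)
        (by rw [Equiv.symm_apply_apply]; exact_mod_cast hv)
      obtain ⟨r', hr', hr''⟩ := lift_low (σ.symm r) (by rw [Fin.val_natAdd] at hr; omega)
      refine ⟨r', hr', ?_⟩
      rw [hr'', Equiv.apply_symm_apply]
      exact ⟨hr1, hr2⟩
    · obtain ⟨r, hr1, hr2, hr⟩ := h2 (σ (skipEmb k m hk j h)) (Fin.lt_def.2 hlt)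
        (by rw [Equiv.symm_apply_apply]; exact_mod_cast hv)
      obtain ⟨r', hr', hr''⟩ := lift_low (σ.symm r) (by rw [Fin.val_natAdd] at hr; omega)
      refine ⟨r', hr', ?_⟩
      rw [hr'', Equiv.apply_symm_apply]
      exact ⟨hr1, hr2⟩
  · intro H
    refine ⟨⟨σ ⟨0, by lia⟩, by simp⟩, fun q hq hlt => ?_, fun q hq hlt => ?_⟩
    · obtain ⟨h, hh, hhq⟩ := lift_high (σ.symm q) (Fin.lt_def.2 (by exact_mod_cast hlt))
      have hσ : σ (skipEmb k m hk j h) = q := by rw [hhq, Equiv.apply_symm_apply]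
      obtain ⟨r, hr, hr1, hr2⟩ := (H h hh).1 (by rw [hσ]; exact hq)
      rw [hσ] at hr1
      have := low r hr
      exact ⟨_, hr1, hr2, by rw [Equiv.symm_apply_apply, Fin.val_natAdd]; omega⟩
    · obtain ⟨h, hh, hhq⟩ := lift_high (σ.symm q) (Fin.lt_def.2 (by exact_mod_cast hlt))
      have hσ : σ (skipEmb k m hk j h) = q := by rw [hhq, Equiv.apply_symm_apply]
      obtain ⟨r, hr, hr1, hr2⟩ := (H h hh).2 (by rw [hσ]; exact hq)
      rw [hσ] at hr2
      have := low r hr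
      exact ⟨_, hr1, hr2, by rw [Equiv.symm_apply_apply, Fin.val_natAdd]; omega⟩

theorem sum_peakCount {k m : ℕ} (hk : 0 < k) :
    (1 + m)! * ∑ w : Equiv.Perm (Fin (k + m)), peakCount k w
      = (k + m)! * ∑ u : Equiv.Perm (Fin (1 + m)), peakCount 1 u := by
  classical
  have main : ∀ K (hK : 0 < K), ∑ w : Equiv.Perm (Fin (K + m)), peakCount K w
      = ∑ j : Fin m, (Finset.univ.filter fun σ : Equiv.Perm (Fin (K + m)) =>
        IsNeighborMax (Fin.natAdd 1 j) fun i => (σ (skipEmb K m hK j i) : ℕ)).card := by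
    intro K hK
    simp only [peakCount, Finset.card_filter]
    rw [← Equiv.sum_comp (Equiv.inv (Equiv.Perm (Fin (K + m))))]
    have : ∀ σ : Equiv.Perm (Fin (K + m)), ∀ f : Fin (K + m) → ℕ,
        ∑ p, f p = ∑ v, f (σ v) := fun σ f => (Equiv.sum_comp σ f).symm
    conv_lhs =>
      enter [2, σ]
      rw [this σ]
    rw [Finset.sum_comm, Fin.sum_univ_add, Finset.sum_eq_zero, zero_add]
    · refine Finset.sum_congr rfl fun j _ => Finset.sum_congr rfl fun σ _ => ?_
      exact if_congr (isProminent_symm_iff hK σ j) rfl rfl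
    · intro i _
      refine Finset.sum_eq_zero fun σ _ => if_neg ?_
      rintro ⟨⟨q, hq⟩, -⟩
      simp only [Equiv.inv_apply, Equiv.Perm.inv_def, Equiv.symm_apply_apply, Fin.val_castAdd] at hq
      omega
  rw [main k hk, main 1 one_pos, Finset.mul_sum, Finset.mul_sum]
  refine Finset.sum_congr rfl fun j _ => ?_
  have hid : ∀ i, skipEmb 1 m one_pos j i = i := by
    intro i
    rcases le_or_gt (i : ℕ) j with h | h
    · exact Fin.ext (skipEmb_of_le one_pos j i h)
    · exact Fin.ext (skipEmb_of_lt one_pos j i h)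
  simp only [hid]
  exact factorial_mul_card_isNeighborMax (skipEmb k m hk j) _

open Classical in
theorem two_mul_card_lt {N : ℕ} {a b : Fin N} (h : a ≠ b) :
    2 * (Finset.univ.filter fun u : Equiv.Perm (Fin N) => u a < u b).card = N ! := by
  have hs : (Finset.univ.filter fun u : Equiv.Perm (Fin N) => u a < u b).card
      = (Finset.univ.filter fun u : Equiv.Perm (Fin N) => u b < u a).card := by
    simp only [Finset.card_filter]
    rw [← Equiv.sum_comp (Equiv.mulRight (Equiv.swap a b))]
    simp
  rw [two_mul]
  nth_rw 2 [hs]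
  simp only [Finset.card_filter]
  rw [← Finset.sum_add_distrib]
  have : ∀ u : Equiv.Perm (Fin N),
      ((if u a < u b then 1 else 0) + if u b < u a then 1 else 0) = 1 := by
    intro u
    rcases lt_or_gt_of_ne (u.injective.ne h) with h | h <;> simp [h, h.not_gt]
  simp [this, Fintype.card_perm]

open Classical in
theorem three_mul_card_lt_lt {N : ℕ} {a b c : Fin N} (hab : a ≠ b) (hcb : c ≠ b) (hac : a ≠ c) :
    3 * (Finset.univ.filter fun u : Equiv.Perm (Fin N) => u a < u b ∧ u c < u b).card = N ! := by
  have h1 : (Finset.univ.filter fun u : Equiv.Perm (Fin N) => u a < u b ∧ u c < u b).card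
      = (Finset.univ.filter fun u : Equiv.Perm (Fin N) => u b < u a ∧ u c < u a).card := by
    simp only [Finset.card_filter]
    rw [← Equiv.sum_comp (Equiv.mulRight (Equiv.swap a b))]
    simp [Equiv.swap_apply_of_ne_of_ne hac.symm hcb]
  have h2 : (Finset.univ.filter fun u : Equiv.Perm (Fin N) => u a < u b ∧ u c < u b).card
      = (Finset.univ.filter fun u : Equiv.Perm (Fin N) => u a < u c ∧ u b < u c).card := by
    simp only [Finset.card_filter]
    rw [← Equiv.sum_comp (Equiv.mulRight (Equiv.swap b c))]
    simp [Equiv.swap_apply_of_ne_of_ne hab hac]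
  have h3 : ∀ x : ℕ, 3 * x = x + x + x := fun x => by ring
  rw [h3]
  nth_rw 2 [h1]
  nth_rw 2 [h2]
  simp only [Finset.card_filter]
  rw [← Finset.sum_add_distrib, ← Finset.sum_add_distrib]
  have : ∀ u : Equiv.Perm (Fin N), ((if u a < u b ∧ u c < u b then 1 else 0) +
      (if u b < u a ∧ u c < u a then 1 else 0) + if u a < u c ∧ u b < u c then 1 else 0) = 1 := by
    intro u
    have e1 := u.injective.ne hab
    have e2 := u.injective.ne hcb
    have e3 := u.injective.ne hac
    split_ifs <;> lia
  simp [this, Fintype.card_perm]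

theorem isProminent_one_iff {N : ℕ} (u : Equiv.Perm (Fin (N + 2))) (p : Fin (N + 2)) :
    IsProminent ((1 : ℕ) : ℤ) (fun i => ((u i : ℕ) : ℤ)) p ↔
      ∀ q : Fin (N + 2), (q : ℕ) + 1 = p ∨ (p : ℕ) + 1 = q → u q < u p := by
  constructor
  · rintro ⟨-, h1, h2⟩ q hq
    by_contra! h
    have hqp : q ≠ p := by rintro rfl; lia
    have hlt : u p < u q := lt_of_le_of_ne h (u.injective.ne hqp.symm)
    rcases hq with hq | hq
    · obtain ⟨r, hr1, hr2, -⟩ := h1 q (Fin.lt_def.2 (by lia)) (Int.ofNat_lt.2 hlt)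
      rw [Fin.lt_def] at hr1 hr2
      lia
    · obtain ⟨r, hr1, hr2, -⟩ := h2 q (Fin.lt_def.2 (by lia)) (Int.ofNat_lt.2 hlt)
      rw [Fin.lt_def] at hr1 hr2
      lia
  · intro h
    have h' : ∀ q : Fin (N + 2), (q : ℕ) + 1 = p ∨ (p : ℕ) + 1 = q →
        ((u q : ℕ) : ℤ) + (1 : ℕ) ≤ ((u p : ℕ) : ℤ) := fun q hq => by
      have := Fin.lt_def.1 (h q hq)
      lia
    refine ⟨?_, fun q hqp hq => ?_, fun q hqp hq => ?_⟩
    · by_cases h0 : (p : ℕ) = 0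
      · exact ⟨⟨1, by lia⟩, h' _ (Or.inr (by simp [h0]))⟩
      · exact ⟨⟨p - 1, by lia⟩, h' _ (Or.inl (by simp; lia))⟩
    · rw [Fin.lt_def] at hqp
      have hr := h' ⟨p - 1, by lia⟩ (Or.inl (by simp; lia))
      refine ⟨⟨p - 1, by lia⟩, ?_, Fin.lt_def.2 (by simp; lia), hr⟩
      refine lt_of_le_of_ne (Fin.le_def.2 (by simp; lia)) ?_
      rintro rfl
      lia
    · rw [Fin.lt_def] at hqp
      have hr := h' ⟨p + 1, by lia⟩ (Or.inr (by simp))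
      refine ⟨⟨p + 1, by lia⟩, Fin.lt_def.2 (by simp), ?_, hr⟩
      refine lt_of_le_of_ne (Fin.le_def.2 (by simp; lia)) ?_
      intro heq
      rw [heq] at hr
      simp only at hq
      omega

theorem three_mul_sum_peakCount_one {N : ℕ} :
    3 * ∑ u : Equiv.Perm (Fin (N + 2)), peakCount 1 u = (N + 3) * (N + 2)! := by
  classical
  simp only [peakCount, isProminent_one_iff]
  simp only [Finset.card_filter]
  rw [Finset.sum_comm, Fin.sum_univ_succ, Fin.sum_univ_castSucc]
  simp only [← Finset.card_filter]
  have first := two_mul_card_lt (a := (1 : Fin (N + 2))) (b := 0) (by simp)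
  have last := two_mul_card_lt (a := (Fin.last N).castSucc) (b := (Fin.last N).succ)
    (by simp [Fin.ext_iff])
  have mid : ∀ i : Fin N, 3 * (Finset.univ.filter fun u : Equiv.Perm (Fin (N + 2)) =>
      ∀ q : Fin (N + 2), (q : ℕ) + 1 = (i.castSucc.succ : Fin (N + 2)) ∨
        ((i.castSucc.succ : Fin (N + 2)) : ℕ) + 1 = q → u q < u i.castSucc.succ).card
      = (N + 2)! := by
    intro i
    rw [← three_mul_card_lt_lt (a := i.castSucc.castSucc) (b := i.castSucc.succ)
      (c := i.succ.succ) (by simp [Fin.ext_iff]) (by simp [Fin.ext_iff])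
      (by simp [Fin.ext_iff]; lia)]
    congr 2
    ext u
    simp only [Finset.mem_filter, Finset.mem_univ, true_and]
    constructor
    · intro h
      exact ⟨h _ (Or.inl (by simp)), h _ (Or.inr (by simp))⟩
    · rintro ⟨h1, h2⟩ q (hq | hq)
      · convert h1 using 2
        exact Fin.ext (by simpa using hq)
      · convert h2 using 2
        exact Fin.ext (by simpa using hq.symm)
  have first' : (Finset.univ.filter fun u : Equiv.Perm (Fin (N + 2)) =>
      ∀ q : Fin (N + 2), (q : ℕ) + 1 = (0 : Fin (N + 2)) ∨
        ((0 : Fin (N + 2)) : ℕ) + 1 = q → u q < u 0)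
      = Finset.univ.filter fun u : Equiv.Perm (Fin (N + 2)) => u 1 < u 0 := by
    ext u
    simp only [Finset.mem_filter, Finset.mem_univ, true_and]
    constructor
    · intro h
      exact h _ (Or.inr (by simp))
    · rintro h q (hq | hq)
      · simp at hq
      · convert h using 2
        exact Fin.ext (by simpa using hq.symm)
  have last' : (Finset.univ.filter fun u : Equiv.Perm (Fin (N + 2)) =>
      ∀ q : Fin (N + 2), (q : ℕ) + 1 = ((Fin.last N).succ : Fin (N + 2)) ∨
        (((Fin.last N).succ : Fin (N + 2)) : ℕ) + 1 = q → u q < u (Fin.last N).succ)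
      = Finset.univ.filter fun u : Equiv.Perm (Fin (N + 2)) =>
        u (Fin.last N).castSucc < u (Fin.last N).succ := by
    ext u
    simp only [Finset.mem_filter, Finset.mem_univ, true_and]
    constructor
    · intro h
      exact h _ (Or.inl (by simp))
    · rintro h q (hq | hq)
      · convert h using 2
        exact Fin.ext (by simpa using hq)
      · have := q.isLt
        simp at hq
        lia
  rw [first', last', mul_add, mul_add, Finset.mul_sum, Finset.sum_congr rfl fun i _ => mid i]
  simp only [Finset.sum_const, Finset.card_univ, Fintype.card_fin, smul_eq_mul]
  linarith

end Perm

/-- For `n ≥ k+1 ≥ 2` the average `k`-zigzagging length of permutations in `S_n`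
is `(2(n-k)+4)/3`, i.e. `3 · Σ_w zs_k(w) = (2(n-k)+4) · n!`. -/
theorem average_k_zigzagging_length (n k : ℕ) (hk : 2 ≤ k + 1) (hkn : k + 1 ≤ n) :
    3 * ∑ w : Equiv.Perm (Fin n), kZigLen n k w = (2 * (n - k) + 4) * n ! := by
  have hk0 : 0 < k := by lia
  obtain ⟨N, rfl⟩ : ∃ N, n = k + (N + 1) := ⟨n - k - 1, by lia⟩
  simp only [kZigLen_eq_card hk0 hkn, card_prominentSet hk0]
  have hrev : ∑ w : Equiv.Perm (Fin (k + (N + 1))), peakCount k (Fin.revPerm * w)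
      = ∑ w : Equiv.Perm (Fin (k + (N + 1))), peakCount k w :=
    Equiv.sum_comp (Equiv.mulLeft Fin.revPerm) (peakCount k)
  rw [Finset.sum_add_distrib, hrev]
  have h1 := sum_peakCount (m := N + 1) hk0
  have hM : 1 + (N + 1) = N + 2 := by lia
  rw [hM] at h1
  have h2 := three_mul_sum_peakCount_one (N := N)
  refine Nat.eq_of_mul_eq_mul_left (Nat.factorial_pos (N + 2)) ?_
  rw [Nat.add_sub_cancel_left]
  linear_combination 6 * h1 + 2 * (k + (N + 1))! * h2
end

section
/- For all integers n and k with n ≥ k+1 ≥ 2, exactly n!/2 permutations w ∈ S_n satisfy zs_k(w) = as_k(w) + 1, and the remaining n!/2 permutations satisfy zs_k(w) = as_k(w). -/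
open Nat

/-- The complement of a permutation, reversing the order of its values. -/
def permCompl {n : ℕ} (w : Equiv.Perm (Fin n)) : Equiv.Perm (Fin n) := w.trans Fin.revPerm

theorem permCompl_permCompl {n : ℕ} (w : Equiv.Perm (Fin n)) :
    permCompl (permCompl w) = w := by
  ext i
  simp [permCompl]

theorem val_permCompl_add {n : ℕ} (w : Equiv.Perm (Fin n)) (i : Fin n) :
    (permCompl w i : ℕ) + (w i : ℕ) + 1 = n := by
  have h := (w i).isLt
  simp only [permCompl, Equiv.trans_apply, Fin.revPerm_apply, Fin.val_rev]
  omega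

/-- There is a `k`-alternating subsequence of `w` of length `s`. -/
def HasKAlt (k : ℕ) {n : ℕ} (w : Equiv.Perm (Fin n)) (s : ℕ) : Prop :=
  ∃ ι : Fin s → Fin n, IsAltSeq w ι ∧ HasGaps k w ι

/-- There is a `k`-reverse-alternating subsequence of `w` of length `s`. -/
def HasKRevAlt (k : ℕ) {n : ℕ} (w : Equiv.Perm (Fin n)) (s : ℕ) : Prop :=
  ∃ ι : Fin s → Fin n, IsRevAltSeq w ι ∧ HasGaps k w ι

theorem isAltSeq_permCompl {n s : ℕ} (w : Equiv.Perm (Fin n)) (ι : Fin s → Fin n) :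
    IsAltSeq (permCompl w) ι ↔ IsRevAltSeq w ι := by
  unfold IsAltSeq IsRevAltSeq
  refine and_congr_right fun _ => forall_congr' fun j => forall_congr' fun hj => ?_
  have h1 := val_permCompl_add w (ι ⟨j, Nat.lt_of_succ_lt hj⟩)
  have h2 := val_permCompl_add w (ι ⟨j + 1, hj⟩)
  split_ifs <;> omega

theorem hasGaps_permCompl {k n s : ℕ} (w : Equiv.Perm (Fin n)) (ι : Fin s → Fin n) :
    HasGaps k (permCompl w) ι ↔ HasGaps k w ι := by
  unfold HasGaps
  refine forall_congr' fun j => forall_congr' fun hj => ?_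
  have h1 := val_permCompl_add w (ι ⟨j, Nat.lt_of_succ_lt hj⟩)
  have h2 := val_permCompl_add w (ι ⟨j + 1, hj⟩)
  simp only [le_abs]
  omega

theorem hasKAlt_permCompl {k n s : ℕ} (w : Equiv.Perm (Fin n)) :
    HasKAlt k (permCompl w) s ↔ HasKRevAlt k w s := by
  simp only [HasKAlt, HasKRevAlt, isAltSeq_permCompl, hasGaps_permCompl]

theorem hasKRevAlt_permCompl {k n s : ℕ} (w : Equiv.Perm (Fin n)) :
    HasKRevAlt k (permCompl w) s ↔ HasKAlt k w s := by
  rw [← hasKAlt_permCompl, permCompl_permCompl]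

theorem strictMono_fin_cons {n s : ℕ} {ι : Fin (s + 1) → Fin n} (hι : StrictMono ι)
    {p : Fin n} (hp : p < ι 0) : StrictMono (Fin.cons p ι : Fin (s + 2) → Fin n) := by
  rw [Fin.strictMono_iff_lt_succ]
  intro i
  refine Fin.cases ?_ (fun i => ?_) i
  · simpa using hp
  · rw [← Fin.succ_castSucc, Fin.cons_succ, Fin.cons_succ]
    exact hι Fin.castSucc_lt_succ

theorem isRevAltSeq_cons {n s : ℕ} {w : Equiv.Perm (Fin n)} {ι : Fin (s + 1) → Fin n}
    (hι : IsAltSeq w ι) {p : Fin n} (hp : p < ι 0) (hw : (w p : ℕ) < (w (ι 0) : ℕ)) :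
    IsRevAltSeq w (Fin.cons p ι : Fin (s + 2) → Fin n) := by
  refine ⟨strictMono_fin_cons hι.1 hp, fun j hj => ?_⟩
  rcases j with _ | j
  · exact hw
  · have h := hι.2 j (by omega)
    change if (j + 1) % 2 = 0 then
        (w (ι ⟨j, by omega⟩) : ℕ) < (w (ι ⟨j + 1, by omega⟩) : ℕ)
      else (w (ι ⟨j + 1, by omega⟩) : ℕ) < (w (ι ⟨j, by omega⟩) : ℕ)
    split_ifs at h ⊢ <;> first | exact h | omega

theorem isAltSeq_cons {n s : ℕ} {w : Equiv.Perm (Fin n)} {ι : Fin (s + 1) → Fin n}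
    (hι : IsRevAltSeq w ι) {p : Fin n} (hp : p < ι 0) (hw : (w (ι 0) : ℕ) < (w p : ℕ)) :
    IsAltSeq w (Fin.cons p ι : Fin (s + 2) → Fin n) := by
  have h1 := val_permCompl_add w p
  have h2 := val_permCompl_add w (ι 0)
  rw [← permCompl_permCompl w, isAltSeq_permCompl]
  exact isRevAltSeq_cons ((isAltSeq_permCompl w ι).2 hι) hp (by omega)

theorem hasGaps_cons {k n s : ℕ} {w : Equiv.Perm (Fin n)} {ι : Fin (s + 1) → Fin n}
    (hι : HasGaps k w ι) {p : Fin n}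
    (hw : (k : ℤ) ≤ |((w p : ℕ) : ℤ) - ((w (ι 0) : ℕ) : ℤ)|) :
    HasGaps k w (Fin.cons p ι : Fin (s + 2) → Fin n) := by
  intro j hj
  rcases j with _ | j
  · exact hw
  · exact hι j (by omega)

theorem isRevAltSeq_tail {n s : ℕ} {w : Equiv.Perm (Fin n)} {ι : Fin (s + 1) → Fin n}
    (hι : IsAltSeq w ι) : IsRevAltSeq w (fun i : Fin s => ι i.succ) := by
  refine ⟨hι.1.comp Fin.strictMono_succ, fun j hj => ?_⟩
  have h := hι.2 (j + 1) (by omega)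
  simp only [Fin.succ_mk]
  split_ifs at h ⊢ <;> first | exact h | omega

theorem hasGaps_tail {k n s : ℕ} {w : Equiv.Perm (Fin n)} {ι : Fin (s + 1) → Fin n}
    (hι : HasGaps k w ι) : HasGaps k w (fun i : Fin s => ι i.succ) :=
  fun j hj => hι (j + 1) (by omega)

theorem HasKAlt.tail {k n s : ℕ} {w : Equiv.Perm (Fin n)} (h : HasKAlt k w (s + 1)) :
    HasKRevAlt k w s := by
  obtain ⟨ι, h1, h2⟩ := h
  exact ⟨_, isRevAltSeq_tail h1, hasGaps_tail h2⟩

/-- Among the pairs of positions of `w` whose values differ by at least `k`, one whose right end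
is leftmost is a `k`-up. -/
def FirstKUp (k : ℕ) {n : ℕ} (w : Equiv.Perm (Fin n)) : Prop :=
  ∃ p t : Fin n, IsKUp k w p t ∧ ∀ i j : Fin n, i < t → j < t → (w i : ℕ) < (w j : ℕ) + k

theorem firstKUp_or_firstKUp_permCompl {k n : ℕ} (hk : 1 ≤ k) (hkn : k + 1 ≤ n)
    (w : Equiv.Perm (Fin n)) : FirstKUp k w ∨ FirstKUp k (permCompl w) := by
  classical
  let P : ℕ → Prop := fun t => ∃ i j : Fin n, i < j ∧ (j : ℕ) = t ∧
    ((w i : ℕ) + k ≤ (w j : ℕ) ∨ (w j : ℕ) + k ≤ (w i : ℕ))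
  have hP : ∃ t, P t := by
    let a := w.symm ⟨0, by omega⟩
    let b := w.symm ⟨n - 1, by omega⟩
    have ha : (w a : ℕ) = 0 := by simp [a]
    have hb : (w b : ℕ) = n - 1 := by simp [b]
    rcases lt_trichotomy a b with h | h | h
    · exact ⟨_, a, b, h, rfl, by omega⟩
    · rw [h] at ha
      omega
    · exact ⟨_, b, a, h, rfl, by omega⟩
  obtain ⟨p, t, hpt, ht, hw⟩ := Nat.find_spec hP
  have hmin : ∀ i j : Fin n, i < t → j < t → (w i : ℕ) < (w j : ℕ) + k := by
    intro i j hi hj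
    by_contra hij
    rcases lt_trichotomy i j with h | h | h
    · exact Nat.find_min hP (m := j) (by omega) ⟨i, j, h, rfl, by omega⟩
    · subst h
      omega
    · exact Nat.find_min hP (m := i) (by omega) ⟨j, i, h, rfl, by omega⟩
  rcases hw with hw | hw
  · exact Or.inl ⟨p, t, ⟨hpt, hw⟩, hmin⟩
  · have hc := val_permCompl_add w
    refine Or.inr ⟨p, t, ⟨hpt, ?_⟩, fun i j hi hj => ?_⟩
    · have h1 := hc p
      have h2 := hc t
      omega
    · have h1 := hc i
      have h2 := hc j
      have h3 := hmin j i hj hi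
      omega

theorem HasKAlt.hasKRevAlt_succ {k n s : ℕ} {w : Equiv.Perm (Fin n)} (hk : 1 ≤ k)
    (hw : FirstKUp k w) (h : HasKAlt k w s) : HasKRevAlt k w (s + 1) := by
  obtain ⟨p, t, ⟨hpt, hup⟩, hmin⟩ := hw
  obtain ⟨ι, hι, hg⟩ := h
  rcases s with _ | _ | s
  · exact ⟨fun _ => p, ⟨Subsingleton.strictMono (α := Fin 1) _, fun j hj => by omega⟩,
      fun j hj => by omega⟩
  · refine ⟨Fin.cons p fun _ => t, isRevAltSeq_cons
      ⟨Subsingleton.strictMono (α := Fin 1) _, fun j hj => by omega⟩ hpt (by omega),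
      hasGaps_cons (fun j hj => by omega) ?_⟩
    rw [le_abs]
    omega
  · have h01 : ι 0 < ι 1 := hι.1 (by simp)
    have hd : (w (ι 1) : ℕ) + k ≤ (w (ι 0) : ℕ) := by
      have h1 : (w (ι 1) : ℕ) < (w (ι 0) : ℕ) := hι.2 0 (by omega)
      have h2 : (k : ℤ) ≤ |((w (ι 0) : ℕ) : ℤ) - ((w (ι 1) : ℕ) : ℤ)| := hg 0 (by omega)
      rw [le_abs] at h2
      omega
    obtain ⟨q, hq1, hpq, hqd, hqu⟩ : ∃ q : Fin n, q < ι 1 ∧ p < q ∧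
        (w (ι 1) : ℕ) + k ≤ (w q : ℕ) ∧ (w p : ℕ) + k ≤ (w q : ℕ) := by
      by_cases hq : t ≤ ι 0 ∧ w t ≤ w (ι 0)
      · exact ⟨ι 0, h01, by omega, hd, by omega⟩
      · by_cases ht : t ≤ ι 0
        · exact ⟨t, by omega, hpt, by omega, hup⟩
        · have h1 := hmin (ι 0) p (by omega) hpt
          refine ⟨t, ?_, hpt, by omega, hup⟩
          by_contra hle
          rcases lt_or_eq_of_le (not_lt.1 hle) with hlt | heq
          · have h2 := hmin (ι 0) (ι 1) (by omega) hlt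
            omega
          · rw [heq] at hd
            omega
    have hA := isAltSeq_cons (isRevAltSeq_tail hι) (p := q) hq1
      (show (w (ι 1) : ℕ) < (w q : ℕ) by omega)
    have hG := hasGaps_cons (hasGaps_tail hg) (p := q)
      (show (k : ℤ) ≤ |((w q : ℕ) : ℤ) - ((w (ι 1) : ℕ) : ℤ)| by rw [le_abs]; omega)
    refine ⟨Fin.cons p _, isRevAltSeq_cons hA hpq
      (show (w p : ℕ) < (w q : ℕ) by omega), hasGaps_cons hG ?_⟩
    change (k : ℤ) ≤ |((w p : ℕ) : ℤ) - ((w q : ℕ) : ℤ)|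
    rw [le_abs]
    omega

theorem le_of_strictMono_fin {n s : ℕ} {ι : Fin s → Fin n} (hι : StrictMono ι) : s ≤ n := by
  simpa using Fintype.card_le_of_injective ι hι.injective

theorem HasKAlt.le {k n s : ℕ} {w : Equiv.Perm (Fin n)} (h : HasKAlt k w s) : s ≤ n :=
  le_of_strictMono_fin h.choose_spec.1.1

theorem HasKRevAlt.le {k n s : ℕ} {w : Equiv.Perm (Fin n)} (h : HasKRevAlt k w s) : s ≤ n :=
  le_of_strictMono_fin h.choose_spec.1.1

theorem hasKAlt_kAltLen {k n : ℕ} (w : Equiv.Perm (Fin n)) : HasKAlt k w (kAltLen n k w) :=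
  Nat.sSup_mem (s := {s | HasKAlt k w s})
    ⟨0, Fin.elim0, ⟨Subsingleton.strictMono _, fun j hj => by omega⟩, fun j hj => by omega⟩
    ⟨n, fun _ h => h.le⟩

theorem HasKAlt.le_kAltLen {k n s : ℕ} {w : Equiv.Perm (Fin n)} (h : HasKAlt k w s) :
    s ≤ kAltLen n k w :=
  le_csSup (s := {s | HasKAlt k w s}) ⟨n, fun _ h => h.le⟩ h

theorem kAltLen_permCompl {k n : ℕ} (w : Equiv.Perm (Fin n)) :
    kAltLen n k (permCompl w) = kRevAltLen n k w :=
  congrArg sSup (Set.ext fun _ => hasKAlt_permCompl w)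

theorem kRevAltLen_permCompl {k n : ℕ} (w : Equiv.Perm (Fin n)) :
    kRevAltLen n k (permCompl w) = kAltLen n k w := by
  rw [← kAltLen_permCompl, permCompl_permCompl]

theorem hasKRevAlt_kRevAltLen {k n : ℕ} (w : Equiv.Perm (Fin n)) :
    HasKRevAlt k w (kRevAltLen n k w) := by
  rw [← hasKAlt_permCompl, ← kAltLen_permCompl]
  exact hasKAlt_kAltLen _

theorem HasKRevAlt.le_kRevAltLen {k n s : ℕ} {w : Equiv.Perm (Fin n)} (h : HasKRevAlt k w s) :
    s ≤ kRevAltLen n k w := by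
  rw [← kAltLen_permCompl]
  exact ((hasKAlt_permCompl w).2 h).le_kAltLen

theorem kZigLen_eq_max {k n : ℕ} (w : Equiv.Perm (Fin n)) :
    kZigLen n k w = max (kAltLen n k w) (kRevAltLen n k w) := by
  have hset : {s : ℕ | ∃ ι : Fin s → Fin n, (IsAltSeq w ι ∨ IsRevAltSeq w ι) ∧ HasGaps k w ι} =
      {s | HasKAlt k w s} ∪ {s | HasKRevAlt k w s} := by
    ext s
    simp only [HasKAlt, HasKRevAlt, Set.mem_union, Set.mem_ofPred_eq, or_and_right, exists_or]
  unfold kZigLen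
  rw [hset]
  exact csSup_union (s := {s | HasKAlt k w s}) (t := {s | HasKRevAlt k w s})
    ⟨n, fun _ h => HasKAlt.le h⟩ ⟨_, hasKAlt_kAltLen w⟩
    ⟨n, fun _ h => HasKRevAlt.le h⟩ ⟨_, hasKRevAlt_kRevAltLen w⟩

theorem kAltLen_le_kRevAltLen_add_one {k n : ℕ} (w : Equiv.Perm (Fin n)) :
    kAltLen n k w ≤ kRevAltLen n k w + 1 := by
  have h := hasKAlt_kAltLen (k := k) w
  rcases hs : kAltLen n k w with _ | s
  · omega
  · rw [hs] at h
    have := h.tail.le_kRevAltLen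
    omega

theorem kRevAltLen_le_kAltLen_add_one {k n : ℕ} (w : Equiv.Perm (Fin n)) :
    kRevAltLen n k w ≤ kAltLen n k w + 1 := by
  have h := kAltLen_le_kRevAltLen_add_one (k := k) (permCompl w)
  rwa [kAltLen_permCompl, kRevAltLen_permCompl] at h

theorem FirstKUp.kAltLen_lt {k n : ℕ} {w : Equiv.Perm (Fin n)} (hk : 1 ≤ k)
    (hw : FirstKUp k w) : kAltLen n k w < kRevAltLen n k w :=
  ((hasKAlt_kAltLen w).hasKRevAlt_succ hk hw).le_kRevAltLen

theorem kAltLen_ne_kRevAltLen {k n : ℕ} (hk : 1 ≤ k) (hkn : k + 1 ≤ n)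
    (w : Equiv.Perm (Fin n)) : kAltLen n k w ≠ kRevAltLen n k w := by
  rcases firstKUp_or_firstKUp_permCompl hk hkn w with h | h
  · exact (h.kAltLen_lt hk).ne
  · have := h.kAltLen_lt hk
    rw [kAltLen_permCompl, kRevAltLen_permCompl] at this
    exact this.ne.symm

/-- For `n ≥ k+1 ≥ 2`, exactly `n!/2` permutations satisfy `zs_k(w) = as_k(w) + 1`
and the remaining `n!/2` permutations satisfy `zs_k(w) = as_k(w)`. -/
theorem card_zig_eq_alt_add_one (n k : ℕ) (hk : 2 ≤ k + 1) (hkn : k + 1 ≤ n) :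
    2 * Nat.card {w : Equiv.Perm (Fin n) // kZigLen n k w = kAltLen n k w + 1} = n ! ∧
    2 * Nat.card {w : Equiv.Perm (Fin n) // kZigLen n k w = kAltLen n k w} = n ! := by
  classical
  have hk1 : 1 ≤ k := by omega
  have hnot : ∀ w : Equiv.Perm (Fin n),
      kZigLen n k w = kAltLen n k w ↔ ¬ kZigLen n k w = kAltLen n k w + 1 := by
    intro w
    have h1 := kAltLen_ne_kRevAltLen hk1 hkn w
    have h2 := kAltLen_le_kRevAltLen_add_one (k := k) w
    have h3 := kRevAltLen_le_kAltLen_add_one (k := k) w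
    rw [kZigLen_eq_max]
    omega
  have hcompl : ∀ w : Equiv.Perm (Fin n),
      kZigLen n k w = kAltLen n k w + 1 ↔
        kZigLen n k (permCompl w) = kAltLen n k (permCompl w) := by
    intro w
    have h1 := kAltLen_ne_kRevAltLen hk1 hkn w
    have h2 := kAltLen_le_kRevAltLen_add_one (k := k) w
    have h3 := kRevAltLen_le_kAltLen_add_one (k := k) w
    rw [kZigLen_eq_max, kZigLen_eq_max, kAltLen_permCompl, kRevAltLen_permCompl]
    omega
  have hcard : Nat.card {w : Equiv.Perm (Fin n) // kZigLen n k w = kAltLen n k w + 1} =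
      Nat.card {w : Equiv.Perm (Fin n) // kZigLen n k w = kAltLen n k w} :=
    Nat.card_congr (Equiv.subtypeEquiv
      ⟨permCompl, permCompl, permCompl_permCompl, permCompl_permCompl⟩ hcompl)
  have hsum : Nat.card {w : Equiv.Perm (Fin n) // kZigLen n k w = kAltLen n k w + 1} +
      Nat.card {w : Equiv.Perm (Fin n) // kZigLen n k w = kAltLen n k w} = n ! := by
    rw [Nat.card_congr (Equiv.subtypeEquivRight hnot), ← Nat.card_sum,
      Nat.card_congr (Equiv.sumCompl _), Nat.card_perm, Nat.card_fin]
  omega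
end
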